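/- Let 𝒜 ⊆ ℬ be two collections of subgroups of G, each closed under conjugation and under passing to subgroups. Let T_ℬ be a JSJ tree of G over ℬ, and assume G admits a JSJ tree over 𝒜. Then there exist a G-tree T̂, a collapse map T̂ → T_ℬ, and a collapse map q : T̂ → T' whose collapsed edges are exactly the edges of T̂ with stabilizer not in 𝒜, such that T' is a JSJ tree of G over 𝒜. In particular, some JSJ tree over 𝒜 is compatible with T_ℬ (they have a common refinement). -/

import Mathlib

universe u v

/-- A `G`-tree: a nonempty simple graph which is a tree (connected and acyclic),
with a minimal action of `G` by graph automorphisms without inversions. -/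
structure GTree (G : Type u) [Group G] : Type (u + 1) where
  V : Type u
  graph : SimpleGraph V
  nonempty : Nonempty V
  connected : graph.Connected
  acyclic : graph.IsAcyclic
  act : G → V → V
  act_one : ∀ w, act 1 w = w
  act_mul : ∀ g h w, act (g * h) w = act g (act h w)
  act_adj : ∀ g a b, graph.Adj a b → graph.Adj (act g a) (act g b)
  noInversion : ∀ g a b, graph.Adj a b → ¬(act g a = b ∧ act g b = a)
  minimal : ∀ S : Set V, S.Nonempty → (∀ g, ∀ w ∈ S, act g w ∈ S) →
    (graph.induce S).Connected → S = Set.univ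

namespace GTree

variable {G : Type u} [Group G]

/-- The stabilizer of a vertex. -/
def vertexStab (T : GTree G) (w : T.V) : Subgroup G where
  carrier := {g | T.act g w = w}
  one_mem' := T.act_one w
  mul_mem' := by
    intro a b ha hb
    simp only [Set.mem_setOf_eq] at *
    rw [T.act_mul, hb, ha]
  inv_mem' := by
    intro a ha
    simp only [Set.mem_setOf_eq] at *
    calc T.act a⁻¹ w = T.act a⁻¹ (T.act a w) := by rw [ha]
    _ = T.act (a⁻¹ * a) w := (T.act_mul _ _ _).symm
    _ = w := by rw [inv_mul_cancel, T.act_one]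

/-- The stabilizer of an edge `{u,v}`: elements fixing both endpoints. -/
def edgeStab (T : GTree G) (a b : T.V) : Subgroup G :=
  T.vertexStab a ⊓ T.vertexStab b

/-- A subgroup is elliptic in `T` if it fixes a vertex. -/
def EllipticSubgroup (T : GTree G) (H : Subgroup G) : Prop :=
  ∃ w : T.V, ∀ h ∈ H, T.act h w = w

/-- An element is elliptic in `T` if it fixes a vertex (otherwise it is hyperbolic). -/
def EllipticElt (T : GTree G) (g : G) : Prop :=
  ∃ w : T.V, T.act g w = w

/-- `T₁` dominates `T₂`: every subgroup elliptic in `T₁` is elliptic in `T₂`. -/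
def Dominates (T₁ T₂ : GTree G) : Prop :=
  ∀ H : Subgroup G, T₁.EllipticSubgroup H → T₂.EllipticSubgroup H

/-- `T` is an `𝒜`-tree: all its edge stabilizers belong to `𝒜`. -/
def IsATree (T : GTree G) (𝒜 : Set (Subgroup G)) : Prop :=
  ∀ a b : T.V, T.graph.Adj a b → T.edgeStab a b ∈ 𝒜

/-- A subgroup is universally elliptic if it is elliptic in every `𝒜`-tree. -/
def UnivEllipticSubgroup (𝒜 : Set (Subgroup G)) (H : Subgroup G) : Prop :=
  ∀ T : GTree G, T.IsATree 𝒜 → T.EllipticSubgroup H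

/-- An `𝒜`-tree is universally elliptic if all its edge stabilizers are universally elliptic. -/
def UnivEllipticTree (T : GTree G) (𝒜 : Set (Subgroup G)) : Prop :=
  ∀ a b : T.V, T.graph.Adj a b → UnivEllipticSubgroup 𝒜 (T.edgeStab a b)

/-- A JSJ tree of `G` over `𝒜`: a universally elliptic `𝒜`-tree dominating every
universally elliptic `𝒜`-tree. -/
def IsJSJ (T : GTree G) (𝒜 : Set (Subgroup G)) : Prop :=
  T.IsATree 𝒜 ∧ T.UnivEllipticTree 𝒜 ∧
    ∀ T' : GTree G, T'.IsATree 𝒜 → T'.UnivEllipticTree 𝒜 → T.Dominates T'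

/-- A collapse map `T → T'`: a `G`-equivariant surjection on vertices sending adjacent
vertices to adjacent or equal vertices, with connected point preimages. -/
def IsCollapseMap (T T' : GTree G) (f : T.V → T'.V) : Prop :=
  (∀ g w, f (T.act g w) = T'.act g (f w)) ∧
    Function.Surjective f ∧
    (∀ a b : T.V, T.graph.Adj a b → f a = f b ∨ T'.graph.Adj (f a) (f b)) ∧
    ∀ w : T'.V, (T.graph.induce (f ⁻¹' {w})).Connected

end GTree

/-- `𝒜` is closed under conjugation and under passing to subgroups. -/
def ClosedFamily {G : Type u} [Group G] (𝒜 : Set (Subgroup G)) : Prop :=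
  (∀ H ∈ 𝒜, ∀ g : G, Subgroup.map (MulAut.conj g).toMonoidHom H ∈ 𝒜) ∧
    ∀ H ∈ 𝒜, ∀ K : Subgroup G, K ≤ H → K ∈ 𝒜

/-- `G` is finitely presented: it admits a presentation with finitely many generators
and finitely many relations. -/
def FinitelyPresentedGroup (G : Type u) [Group G] : Prop :=
  ∃ (n : ℕ) (rels : Set (FreeGroup (Fin n))),
    rels.Finite ∧ Nonempty (PresentedGroup rels ≃* G)

/-- `T` is an `(𝒜,ℋ)`-tree: an `𝒜`-tree in which every subgroup in `ℋ` is elliptic. -/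
def RelATree {G : Type u} [Group G] (𝒜 ℋ : Set (Subgroup G)) (T : GTree G) : Prop :=
  T.IsATree 𝒜 ∧ ∀ H ∈ ℋ, T.EllipticSubgroup H

/-- A subgroup is universally elliptic relative to `ℋ` if it is elliptic in every
`(𝒜,ℋ)`-tree. -/
def RelUnivEllipticSubgroup {G : Type u} [Group G] (𝒜 ℋ : Set (Subgroup G))
    (K : Subgroup G) : Prop :=
  ∀ T : GTree G, RelATree 𝒜 ℋ T → T.EllipticSubgroup K

/-- An `(𝒜,ℋ)`-tree is universally elliptic if all its edge stabilizers are universally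
elliptic relative to `ℋ`. -/
def RelUnivEllipticTree {G : Type u} [Group G] (𝒜 ℋ : Set (Subgroup G))
    (T : GTree G) : Prop :=
  ∀ a b : T.V, T.graph.Adj a b → RelUnivEllipticSubgroup 𝒜 ℋ (T.edgeStab a b)

/-- A JSJ tree of `G` over `𝒜` relative to `ℋ`. -/
def IsRelJSJ {G : Type u} [Group G] (𝒜 ℋ : Set (Subgroup G)) (T : GTree G) : Prop :=
  RelATree 𝒜 ℋ T ∧ RelUnivEllipticTree 𝒜 ℋ T ∧
    ∀ T' : GTree G, RelATree 𝒜 ℋ T' → RelUnivEllipticTree 𝒜 ℋ T' → T.Dominates T'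

/-- The family of groups `F, H₁, …, H_p` whose free product is used to define relative
finite presentability. -/
def relFam {G : Type u} [Group G] {p : ℕ} (H : Fin p → Subgroup G) (n : ℕ) :
    Option (Fin p) → Type u
  | none => FreeGroup (ULift.{u} (Fin n))
  | some j => H j

instance relFamGroup {G : Type u} [Group G] {p : ℕ} (H : Fin p → Subgroup G) (n : ℕ) :
    (i : Option (Fin p)) → Group (relFam H n i)
  | none => inferInstanceAs (Group (FreeGroup _))
  | some j => inferInstanceAs (Group (H j))

/-- `G` is finitely presented relative to `H₁, …, H_p`: there is a surjection from
`F ∗ H₁ ∗ ⋯ ∗ H_p` (with `F` a finitely generated free group) onto `G` restricting to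
the inclusion on each `Hᵢ`, whose kernel is the normal closure of a finite subset. -/
def RelFinitelyPresented {G : Type u} [Group G] {p : ℕ} (H : Fin p → Subgroup G) : Prop :=
  ∃ (n : ℕ) (φ : Monoid.CoprodI (relFam H n) →* G),
    Function.Surjective φ ∧
    (∀ (j : Fin p) (h : H j), φ (Monoid.CoprodI.of (M := relFam H n) (i := some j) h) = (h : G)) ∧
    ∃ s : Set (Monoid.CoprodI (relFam H n)), s.Finite ∧
      MonoidHom.ker φ = Subgroup.normalClosure s

/-- `S` has a single orbit of edges. -/
def OneEdgeOrbit {G : Type u} [Group G] (S : GTree G) : Prop :=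
  ∀ e₁ ∈ S.graph.edgeSet, ∀ e₂ ∈ S.graph.edgeSet, ∃ g : G, Sym2.map (S.act g) e₁ = e₂

/-- `G` splits over `K`: there is a nontrivial `G`-tree with a single orbit of edges
having `K` as an edge stabilizer. -/
def SplitsOver {G : Type u} [Group G] (K : Subgroup G) : Prop :=
  ∃ S : GTree G, Nontrivial S.V ∧ OneEdgeOrbit S ∧
    ∃ x y : S.V, S.graph.Adj x y ∧ S.edgeStab x y = K

/-- A subgroup is slender if all its subgroups are finitely generated. -/
def SlenderSubgroup {G : Type u} [Group G] (H : Subgroup G) : Prop :=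
  ∀ K : Subgroup G, K ≤ H → K.FG

/-- A subgroup is abelian. -/
def AbelianSubgroup {G : Type u} [Group G] (H : Subgroup G) : Prop :=
  ∀ a ∈ H, ∀ b ∈ H, a * b = b * a

/-- `H` is malnormal in `G`: `gHg⁻¹ ∩ H ≠ {1}` implies `g ∈ H`. -/
def Malnormal {G : Type u} [Group G] (H : Subgroup G) : Prop :=
  ∀ g : G, (∃ x ∈ H, x ≠ 1 ∧ g * x * g⁻¹ ∈ H) → g ∈ H

/-- `G` is CSA: the centralizer of every nontrivial element is abelian and malnormal. -/
def IsCSA (G : Type u) [Group G] : Prop :=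
  ∀ g : G, g ≠ 1 →
    AbelianSubgroup (Subgroup.centralizer {g}) ∧ Malnormal (Subgroup.centralizer {g})

section Graph

variable {V W : Type*} {P L : SimpleGraph V} {H : SimpleGraph W}

theorem SimpleGraph.Reachable.map_of_adj_reachable (φ : V → W)
    (h : ∀ a b, P.Adj a b → H.Reachable (φ a) (φ b)) {a b : V} (hab : P.Reachable a b) :
    H.Reachable (φ a) (φ b) := by
  obtain ⟨w⟩ := hab
  induction w with
  | nil => exact .rfl
  | cons hadj _ ih => exact (h _ _ hadj).trans ih

theorem SimpleGraph.Connected.of_surjective_of_adj_reachable (φ : V → W)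
    (hφ : Function.Surjective φ) (h : ∀ a b, P.Adj a b → H.Reachable (φ a) (φ b))
    (hP : P.Connected) : H.Connected := by
  have := hP.nonempty.map φ
  refine ⟨fun c d => ?_⟩
  obtain ⟨a, rfl⟩ := hφ c
  obtain ⟨b, rfl⟩ := hφ d
  exact (hP.preconnected a b).map_of_adj_reachable φ h

/-- Reachability lifts along a map with connected fibres over which every edge lifts. -/
theorem SimpleGraph.Reachable.lift_of_fibers (q : V → W)
    (hfib : ∀ a b, q a = q b → L.Reachable a b)
    (hadj : ∀ c d, H.Adj c d → ∃ a b, q a = c ∧ q b = d ∧ L.Reachable a b)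
    {c d : W} (hcd : H.Reachable c d) {a b : V} (ha : q a = c) (hb : q b = d) :
    L.Reachable a b := by
  obtain ⟨w⟩ := hcd
  induction w generalizing a with
  | nil => exact hfib _ _ (ha.trans hb.symm)
  | cons h _ ih =>
    obtain ⟨a', b', rfl, hb', hr⟩ := hadj _ _ h
    exact ((hfib _ _ ha).trans hr).trans (ih hb' hb)

theorem SimpleGraph.IsAcyclic.not_reachable_deleteEdges (hP : P.IsAcyclic) {a b : V}
    (hab : P.Adj a b) : ¬(P.deleteEdges {s(a, b)}).Reachable a b :=
  SimpleGraph.isBridge_iff.1 (SimpleGraph.isAcyclic_iff_forall_adj_isBridge.1 hP hab)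

/-- The intersection of two subtrees of a forest is connected as soon as it is nonempty. -/
theorem SimpleGraph.IsAcyclic.connected_induce_inter (hP : P.IsAcyclic) {M N : Set V}
    (hM : (P.induce M).Connected) (hN : (P.induce N).Connected) (hne : (M ∩ N).Nonempty) :
    (P.induce (M ∩ N)).Connected := by
  have := hne.to_subtype
  refine ⟨fun ⟨a, haM, haN⟩ ⟨b, hbM, hbN⟩ => ?_⟩
  have key : ∀ S : Set V, (P.induce S).Connected → a ∈ S → b ∈ S →
      ∃ p : P.Walk a b, p.IsPath ∧ ∀ x ∈ p.support, x ∈ S := by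
    intro S hS ha hb
    obtain ⟨p, hp⟩ := (hS.preconnected ⟨a, ha⟩ ⟨b, hb⟩).exists_isPath
    have hsupp : ∀ x ∈ (p.map (SimpleGraph.Embedding.induce (G := P) S).toHom).support,
        x ∈ S := by
      intro x hx
      rw [SimpleGraph.Walk.support_map, List.mem_map] at hx
      obtain ⟨y, -, rfl⟩ := hx
      exact y.2
    exact ⟨_, hp.map (SimpleGraph.Embedding.induce (G := P) S).injective, hsupp⟩
  obtain ⟨p, hp, hpM⟩ := key M hM haM hbM
  obtain ⟨p', hp', hpN⟩ := key N hN haN hbN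
  obtain rfl : p = p' := congrArg Subtype.val
    ((hP.subsingleton_path a b).elim ⟨p, hp⟩ ⟨p', hp'⟩)
  exact ⟨p.induce (M ∩ N) fun x hx => ⟨hpM x hx, hpN x hx⟩⟩

end Graph

section Action

variable {G : Type*} [Group G]

/-- A finitely generated group acting on a connected graph has a minimal nonempty invariant
connected set of vertices. -/
theorem exists_minimal_invariant_connected (hfg : Group.FG G) {V : Type*} [MulAction G V]
    (P : SimpleGraph V) (hP : P.Connected)
    (hact : ∀ (g : G) a b, P.Adj a b → P.Adj (g • a) (g • b)) :
    ∃ M : Set V, M.Nonempty ∧ (∀ g : G, ∀ x ∈ M, g • x ∈ M) ∧ (P.induce M).Connected ∧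
      ∀ S ⊆ M, S.Nonempty → (∀ g : G, ∀ x ∈ S, g • x ∈ S) → (P.induce S).Connected →
        S = M := by
  classical
  obtain ⟨gens, hgens, hfin⟩ := Group.fg_iff.1 hfg
  obtain ⟨x⟩ := hP.nonempty
  let w : ∀ s : G, P.Walk x (s • x) := fun s => (hP.preconnected x (s • x)).some
  let K : Set V := {x} ∪ ⋃ s ∈ gens, {y | y ∈ (w s).support}
  have hK : K.Finite := (Set.finite_singleton x).union
    (hfin.biUnion fun s _ => List.finite_toSet _)
  let S₀ : Set V := {y | ∃ g : G, ∃ k ∈ K, y = g • k}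
  have hS₀ : ∀ g : G, ∀ y ∈ S₀, g • y ∈ S₀ := by
    rintro g _ ⟨h, k, hk, rfl⟩
    exact ⟨g * h, k, hk, (mul_smul g h k).symm⟩
  have hx : ∀ g : G, g • x ∈ S₀ := fun g => ⟨g, x, Or.inl rfl, rfl⟩
  have hwalk : ∀ (g : G) (y : V) (p : P.Walk x y), (∀ z ∈ p.support, z ∈ K) →
      ∀ hy : g • y ∈ S₀, (P.induce S₀).Reachable ⟨g • x, hx g⟩ ⟨g • y, hy⟩ := by
    intro g y p hp hy
    let φ : P →g P := ⟨fun z => g • z, fun {a b} h => hact g a b h⟩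
    refine ⟨(p.map φ).induce S₀ fun z hz => ?_⟩
    rw [SimpleGraph.Walk.support_map, List.mem_map] at hz
    obtain ⟨z', hz', rfl⟩ := hz
    exact ⟨g, z', hp z' hz', rfl⟩
  have hgen : ∀ g h : G, (P.induce S₀).Reachable ⟨h • x, hx h⟩ ⟨(h * g) • x, hx _⟩ := by
    intro g
    have hg : g ∈ Subgroup.closure gens := hgens ▸ Subgroup.mem_top g
    induction hg using Subgroup.closure_induction with
    | mem s hs =>
      intro h
      have := hwalk h _ (w s) (fun z hz => Or.inr (Set.mem_biUnion hs hz))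
        (by rw [← mul_smul]; exact hx _)
      simpa only [mul_smul] using this
    | one => intro h; simp
    | mul a b _ _ iha ihb =>
      intro h
      have := (iha h).trans (ihb (h * a))
      simpa only [mul_assoc] using this
    | inv a _ iha =>
      intro h
      have := (iha (h * a⁻¹)).symm
      simpa only [inv_mul_cancel_right] using this
  have hconn : (P.induce S₀).Connected := by
    have : Nonempty S₀ := ⟨⟨_, hx 1⟩⟩
    have hone : ∀ y : S₀, (P.induce S₀).Reachable ⟨(1 : G) • x, hx 1⟩ y := by
      rintro ⟨_, g, k, hk, rfl⟩
      have h1 := hgen g 1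
      simp only [one_mul] at h1
      refine h1.trans ?_
      rcases hk with rfl | hk
      · exact .rfl
      · simp only [Set.mem_iUnion] at hk
        obtain ⟨s, hs, hk⟩ := hk
        exact hwalk g k ((w s).takeUntil k hk) (fun z hz => Or.inr (Set.mem_biUnion hs
          ((w s).support_takeUntil_subset_support hk hz))) _
    exact ⟨fun a b => (hone a).symm.trans (hone b)⟩
  let Q : Set V → Prop := fun M =>
    M ⊆ S₀ ∧ M.Nonempty ∧ (∀ g : G, ∀ y ∈ M, g • y ∈ M) ∧ (P.induce M).Connected
  let n : Set V → ℕ := fun M => (M ∩ K).ncard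
  have hQ : ∃ k M, Q M ∧ n M = k := ⟨_, S₀, ⟨subset_rfl, ⟨_, hx 1⟩, hS₀, hconn⟩, rfl⟩
  obtain ⟨M, ⟨hMS, hMne, hMinv, hMc⟩, hMn⟩ := Nat.find_spec hQ
  refine ⟨M, hMne, hMinv, hMc, fun S hSM hSne hSinv hSc => hSM.antisymm ?_⟩
  have hle : n M ≤ n S :=
    hMn ▸ Nat.find_min' hQ ⟨S, ⟨hSM.trans hMS, hSne, hSinv, hSc⟩, rfl⟩
  have heq : S ∩ K = M ∩ K :=
    Set.eq_of_subset_of_ncard_le (Set.inter_subset_inter_left K hSM) hle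
      (hK.subset Set.inter_subset_right)
  intro y hy
  obtain ⟨g, k, hk, rfl⟩ := hMS hy
  have hkM : k ∈ M := by simpa using hMinv g⁻¹ _ hy
  have hkS : k ∈ S ∩ K := heq ▸ ⟨hkM, hk⟩
  exact hSinv g k hkS.1

/-- Equivariant maps exist on any invariant set of points whose stabilizers have fixed points
in the target. -/
theorem exists_equivariant_map {X Y : Type*} [MulAction G X] [MulAction G Y] [Nonempty Y]
    (C : X → Prop) (hC : ∀ (g : G) x, C x → C (g • x))
    (hfix : ∀ x, C x → ∃ y : Y, MulAction.stabilizer G x ≤ MulAction.stabilizer G y) :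
    ∃ p : X → Y, ∀ x, C x → ∀ g : G, p (g • x) = g • p x := by
  classical
  have hfix' : ∀ x, ∃ y : Y, C x → MulAction.stabilizer G x ≤ MulAction.stabilizer G y := by
    intro x
    by_cases hx : C x
    · exact (hfix x hx).imp fun _ h _ => h
    · exact ⟨Classical.arbitrary Y, fun h => absurd h hx⟩
  choose y₀ hy₀ using hfix'
  let rep : X → X := fun x => (Quotient.mk (MulAction.orbitRel G X) x).out
  have hrep : ∀ x, ∃ g : G, g • rep x = x := fun x => by
    have h : (MulAction.orbitRel G X).r (rep x) x := Quotient.mk_out (s := MulAction.orbitRel G X) x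
    obtain ⟨g, hg⟩ := MulAction.orbitRel_apply.1 h
    exact ⟨g⁻¹, by rw [← hg]; simp⟩
  have hrep_smul : ∀ (g : G) x, rep (g • x) = rep x := fun g x => by
    have : Quotient.mk (MulAction.orbitRel G X) (g • x) = Quotient.mk _ x :=
      Quotient.sound (MulAction.orbitRel_apply.2 ⟨g, rfl⟩)
    simp only [rep, this]
  choose γ hγ using hrep
  refine ⟨fun x => γ x • y₀ (rep x), fun x hx g => ?_⟩
  have hCr : C (rep x) := by
    have := hC (γ x)⁻¹ x hx
    rwa [inv_smul_eq_iff.2 (hγ x).symm] at this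
  have hst : (g * γ x)⁻¹ * γ (g • x) ∈ MulAction.stabilizer G (rep x) := by
    rw [MulAction.mem_stabilizer_iff, mul_smul, inv_smul_eq_iff, mul_smul, hγ x]
    have := hγ (g • x)
    rwa [hrep_smul] at this
  have h := hy₀ _ hCr hst
  rw [MulAction.mem_stabilizer_iff, mul_smul, inv_smul_eq_iff, mul_smul] at h
  simpa only [hrep_smul] using h

end Action

section BlowUp

variable {V W : Type*} (Γ : SimpleGraph V) (Δ : SimpleGraph W) (p : Sym2 V → W)

/-- The graph obtained from `Γ` by blowing up every vertex to a copy of `Δ`, an edge `e` of `Γ`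
being attached at the point `p e` in both copies. -/
def blowUp : SimpleGraph (V × W) where
  Adj a b := (a.1 = b.1 ∧ Δ.Adj a.2 b.2) ∨ (Γ.Adj a.1 b.1 ∧ a.2 = b.2 ∧ a.2 = p s(a.1, b.1))
  symm := ⟨by
    rintro a b (⟨h, h'⟩ | ⟨h, h', h''⟩)
    · exact Or.inl ⟨h.symm, h'.symm⟩
    · exact Or.inr ⟨h.symm, h'.symm, by rw [Sym2.eq_swap, ← h', h'']⟩⟩
  loopless := ⟨by
    rintro a (⟨-, h⟩ | ⟨h, -⟩)
    · exact h.ne rfl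
    · exact h.ne rfl⟩

variable {Γ Δ p}

theorem blowUp_fiber_reachable (hΔ : Δ.Connected) (v : V) (x y : W) :
    (blowUp Γ Δ p).Reachable (v, x) (v, y) :=
  (hΔ.preconnected x y).map_of_adj_reachable (fun z => (v, z)) fun _ _ h =>
    SimpleGraph.Adj.reachable (Or.inl ⟨rfl, h⟩)

theorem blowUp_fiber_connected (hΔ : Δ.Connected) (v : V) :
    ((blowUp Γ Δ p).induce {a | a.1 = v}).Connected := by
  refine hΔ.of_surjective_of_adj_reachable (fun z => ⟨(v, z), rfl⟩) ?_ fun a b h =>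
    SimpleGraph.Adj.reachable (Or.inl ⟨rfl, h⟩)
  rintro ⟨⟨_, z⟩, rfl⟩
  exact ⟨z, rfl⟩

theorem blowUp_connected (hΓ : Γ.Connected) (hΔ : Δ.Connected) : (blowUp Γ Δ p).Connected := by
  have := hΓ.nonempty
  have := hΔ.nonempty
  refine ⟨fun a b => (hΓ.preconnected a.1 b.1).lift_of_fibers Prod.fst ?_ ?_ rfl rfl⟩
  · rintro ⟨v, x⟩ ⟨_, y⟩ rfl
    exact blowUp_fiber_reachable hΔ v x y
  · intro v w h
    exact ⟨(v, p s(v, w)), (w, p s(v, w)), rfl, rfl, SimpleGraph.Adj.reachable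
      (Or.inr ⟨h, rfl, rfl⟩)⟩

theorem blowUp_acyclic (hΓ : Γ.IsAcyclic) (hΔ : Δ.IsAcyclic) : (blowUp Γ Δ p).IsAcyclic := by
  classical
  rw [SimpleGraph.isAcyclic_iff_forall_adj_isBridge]
  rintro ⟨v, x⟩ ⟨w, y⟩ hadj hreach
  rcases hadj with ⟨h, hxy⟩ | ⟨hvw, hxy, hx⟩
  · obtain rfl : v = w := h
    change Δ.Adj x y at hxy
    -- the retraction of the blow-up onto the copy of `Δ` over `v`
    let D : SimpleGraph V := Γ.deleteEdges {e | v ∈ e}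
    let r : V × W → W := fun a => if a.1 = v then a.2 else
      if h : ∃ w, Γ.Adj v w ∧ D.Reachable w a.1 then p s(v, h.choose) else x
    have hr_self : ∀ z, r (v, z) = z := fun z => if_pos rfl
    have hr_nbr : ∀ w z, Γ.Adj v w → r (w, z) = p s(v, w) := by
      intro w z hw
      have hex : ∃ w', Γ.Adj v w' ∧ D.Reachable w' w := ⟨w, hw, .rfl⟩
      have hch : hex.choose = w := by
        obtain ⟨hadj, hD⟩ := hex.choose_spec
        by_contra hne
        refine hΓ.not_reachable_deleteEdges hw ?_
        refine SimpleGraph.Reachable.trans (SimpleGraph.Adj.reachable (v := hex.choose) ?_)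
          (hD.mono ?_)
        · rw [SimpleGraph.deleteEdges_adj]
          exact ⟨hadj, fun h => hne (by simpa [hw.ne] using h)⟩
        · exact SimpleGraph.deleteEdges_anti (by
            rintro _ rfl
            exact Sym2.mem_mk_left v w)
      simp only [r, if_neg hw.ne', dif_pos hex, hch]
    have hr_far : ∀ a b, Γ.Adj a.1 b.1 → a.1 ≠ v → b.1 ≠ v → r a = r b := by
      intro a b hab ha hb
      have hD : D.Adj a.1 b.1 := by
        rw [SimpleGraph.deleteEdges_adj]
        refine ⟨hab, fun h => ?_⟩
        rcases Sym2.mem_iff.1 h with h | h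
        exacts [ha h.symm, hb h.symm]
      have : ∀ w, D.Reachable w a.1 ↔ D.Reachable w b.1 := fun w =>
        ⟨fun h => h.trans hD.reachable, fun h => h.trans hD.symm.reachable⟩
      simp only [r, if_neg ha, if_neg hb, this]
    have hmap := SimpleGraph.Reachable.map_of_adj_reachable
      (H := Δ.deleteEdges {s(x, y)}) r ?_ hreach
    · rw [hr_self, hr_self] at hmap
      exact hΔ.not_reachable_deleteEdges hxy hmap
    rintro ⟨a, s⟩ ⟨b, t⟩ hab
    rw [SimpleGraph.deleteEdges_adj] at hab
    obtain ⟨⟨h, hst⟩ | ⟨hadj, hst, hs⟩, hne⟩ := hab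
    · obtain rfl : a = b := h
      by_cases hav : a = v
      · subst hav
        rw [hr_self, hr_self]
        refine SimpleGraph.Adj.reachable ?_
        rw [SimpleGraph.deleteEdges_adj]
        refine ⟨hst, fun h => hne ?_⟩
        have := congrArg (Sym2.map fun z => (a, z)) (Set.mem_singleton_iff.1 h)
        simpa using this
      · have : r (a, s) = r (a, t) := by simp only [r, if_neg hav]
        rw [this]
    · obtain rfl : s = t := hst
      change Γ.Adj a b at hadj
      change s = p s(a, b) at hs
      have : r (a, s) = r (b, s) := by
        by_cases hav : a = v
        · subst hav
          rw [hr_self, hr_nbr b s hadj, hs]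
        · by_cases hbv : b = v
          · subst hbv
            rw [hr_self, hr_nbr a s hadj.symm, hs, Sym2.eq_swap]
          · exact hr_far _ _ hadj hav hbv
      rw [this]
  · change Γ.Adj v w at hvw
    obtain rfl : x = y := hxy
    change x = p s(v, w) at hx
    refine hΓ.not_reachable_deleteEdges hvw
      (SimpleGraph.Reachable.map_of_adj_reachable Prod.fst ?_ hreach)
    rintro ⟨a, s⟩ ⟨b, t⟩ hab
    rw [SimpleGraph.deleteEdges_adj] at hab
    obtain ⟨⟨h, -⟩ | ⟨hadj, hst, hs⟩, hne⟩ := hab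
    · obtain rfl : a = b := h
      exact .rfl
    · obtain rfl : s = t := hst
      change Γ.Adj a b at hadj
      change s = p s(a, b) at hs
      refine SimpleGraph.Adj.reachable ?_
      rw [SimpleGraph.deleteEdges_adj]
      refine ⟨hadj, fun h => hne ?_⟩
      rw [Set.mem_singleton_iff] at h
      obtain rfl : s = x := by rw [hs, hx, h]
      have := congrArg (Sym2.map fun z => (z, s)) h
      simpa using this

end BlowUp

namespace GTree

variable {G : Type u} [Group G]

instance (T : GTree G) : MulAction G T.V where
  smul := T.act
  one_smul := T.act_one
  mul_smul := T.act_mul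

theorem mem_edgeStab {T : GTree G} {a b : T.V} {g : G} :
    g ∈ T.edgeStab a b ↔ T.act g a = a ∧ T.act g b = b :=
  Iff.rfl

theorem UnivEllipticSubgroup.mono {𝒜 : Set (Subgroup G)} {H K : Subgroup G} (hHK : H ≤ K)
    (hK : UnivEllipticSubgroup 𝒜 K) : UnivEllipticSubgroup 𝒜 H := fun T hT =>
  (hK T hT).imp fun _ hw h hh => hw h (hHK hh)

theorem edgeStab_act_mem_iff {𝒜 : Set (Subgroup G)} (h𝒜 : ClosedFamily 𝒜) (T : GTree G) (g : G)
    (a b : T.V) : T.edgeStab (T.act g a) (T.act g b) ∈ 𝒜 ↔ T.edgeStab a b ∈ 𝒜 := by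
  have key : ∀ (g : G) (a b : T.V), T.edgeStab a b ∈ 𝒜 →
      T.edgeStab (T.act g a) (T.act g b) ∈ 𝒜 := by
    intro g a b h
    refine h𝒜.2 _ (h𝒜.1 _ h g) _ fun k hk => ⟨g⁻¹ * k * g, ?_, by simp [mul_assoc]⟩
    have hcancel : ∀ c : T.V, T.act g⁻¹ (T.act g c) = c := fun c => by
      rw [← T.act_mul, inv_mul_cancel, T.act_one]
    obtain ⟨h1, h2⟩ := hk
    refine ⟨?_, ?_⟩
    · change T.act _ a = a
      rw [T.act_mul, T.act_mul, show T.act k (T.act g a) = T.act g a from h1, hcancel]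
    · change T.act _ b = b
      rw [T.act_mul, T.act_mul, show T.act k (T.act g b) = T.act g b from h2, hcancel]
  refine ⟨fun h => ?_, key g a b⟩
  have := key g⁻¹ _ _ h
  simpa only [← T.act_mul, inv_mul_cancel, T.act_one] using this

/-- A minimal invariant subtree of a forest with an action without inversions. -/
def ofMinimalSubset {V : Type u} [MulAction G V] (P : SimpleGraph V) (hP : P.IsAcyclic)
    (hact : ∀ (g : G) a b, P.Adj a b → P.Adj (g • a) (g • b))
    (hinv : ∀ (g : G) a b, P.Adj a b → ¬(g • a = b ∧ g • b = a))
    (M : Set V) (hMne : M.Nonempty) (hM : ∀ g : G, ∀ x ∈ M, g • x ∈ M)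
    (hMc : (P.induce M).Connected)
    (hmin : ∀ S ⊆ M, S.Nonempty → (∀ g : G, ∀ x ∈ S, g • x ∈ S) → (P.induce S).Connected →
      S = M) : GTree G where
  V := M
  graph := P.induce M
  nonempty := hMne.to_subtype
  connected := hMc
  acyclic := hP.induce M
  act g x := ⟨g • x.1, hM g x.1 x.2⟩
  act_one x := Subtype.ext (one_smul G x.1)
  act_mul g h x := Subtype.ext (mul_smul g h x.1)
  act_adj g a b := hact g a.1 b.1
  noInversion g a b h h' := hinv g a.1 b.1 h
    ⟨congrArg Subtype.val h'.1, congrArg Subtype.val h'.2⟩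
  minimal S hne hS hSc := by
    have := hmin (Subtype.val '' S) (by rintro _ ⟨x, -, rfl⟩; exact x.2) (hne.image _)
      (by rintro g _ ⟨x, hx, rfl⟩; exact ⟨_, hS g x hx, rfl⟩)
      (hSc.of_surjective_of_adj_reachable (fun x => ⟨x.1.1, x.1, x.2, rfl⟩)
        (by rintro ⟨_, x, hx, rfl⟩; exact ⟨⟨x, hx⟩, rfl⟩)
        fun a b h => SimpleGraph.Adj.reachable h)
    refine Set.eq_univ_of_forall fun x => ?_
    have hx : x.1 ∈ Subtype.val '' S := by rw [this]; exact x.2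
    obtain ⟨y, hy, hyx⟩ := hx
    rwa [← Subtype.ext hyx]

section Collapse

/-- The graph on the components of `K` induced by the edges of `T`. -/
def collapseGraph (T : GTree G) (K : SimpleGraph T.V) : SimpleGraph K.ConnectedComponent where
  Adj c d := c ≠ d ∧ ∃ a b, K.connectedComponentMk a = c ∧ K.connectedComponentMk b = d ∧
    T.graph.Adj a b
  symm := ⟨fun _ _ ⟨h, a, b, ha, hb, hab⟩ => ⟨h.symm, b, a, hb, ha, hab.symm⟩⟩
  loopless := ⟨fun _ h => h.1 rfl⟩

variable {T : GTree G} {K : SimpleGraph T.V}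

theorem deleteEdges_adj_of_connectedComponentMk_ne (hK : K ≤ T.graph) {a b c d : T.V}
    (hne : K.connectedComponentMk a ≠ K.connectedComponentMk b) (hcd : K.Adj c d) :
    (T.graph.deleteEdges {s(a, b)}).Adj c d := by
  rw [SimpleGraph.deleteEdges_adj]
  refine ⟨hK hcd, fun h => hne ?_⟩
  rw [Set.mem_singleton_iff] at h
  have hcc := SimpleGraph.ConnectedComponent.connectedComponentMk_eq_of_adj hcd
  rcases Sym2.eq_iff.1 h with ⟨rfl, rfl⟩ | ⟨rfl, rfl⟩
  exacts [hcc, hcc.symm]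

theorem reachable_deleteEdges_of_connectedComponentMk_eq (hK : K ≤ T.graph) {a b c d : T.V}
    (hne : K.connectedComponentMk a ≠ K.connectedComponentMk b)
    (hcd : K.connectedComponentMk c = K.connectedComponentMk d) :
    (T.graph.deleteEdges {s(a, b)}).Reachable c d :=
  (SimpleGraph.ConnectedComponent.exact hcd).mono
    fun _ _ h => deleteEdges_adj_of_connectedComponentMk_ne hK hne h

theorem adj_unique_of_connectedComponentMk (hK : K ≤ T.graph) {a b a' b' : T.V}
    (hne : K.connectedComponentMk a ≠ K.connectedComponentMk b) (hab : T.graph.Adj a b)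
    (hab' : T.graph.Adj a' b') (ha : K.connectedComponentMk a' = K.connectedComponentMk a)
    (hb : K.connectedComponentMk b' = K.connectedComponentMk b) : a' = a ∧ b' = b := by
  by_contra hcon
  refine T.acyclic.not_reachable_deleteEdges hab
    ((reachable_deleteEdges_of_connectedComponentMk_eq hK hne ha.symm).trans
      (SimpleGraph.Reachable.trans (SimpleGraph.Adj.reachable (v := b') ?_)
        (reachable_deleteEdges_of_connectedComponentMk_eq hK hne hb)))
  rw [SimpleGraph.deleteEdges_adj]
  refine ⟨hab', fun h => ?_⟩
  rcases Sym2.eq_iff.1 (Set.mem_singleton_iff.1 h) with h | ⟨rfl, rfl⟩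
  exacts [hcon h, hne hb]

theorem collapseGraph_acyclic (hK : K ≤ T.graph) : (T.collapseGraph K).IsAcyclic := by
  rw [SimpleGraph.isAcyclic_iff_forall_adj_isBridge]
  rintro c d ⟨hne, a, b, rfl, rfl, hab⟩ hreach
  refine T.acyclic.not_reachable_deleteEdges hab
    (SimpleGraph.Reachable.lift_of_fibers K.connectedComponentMk
      (fun _ _ => reachable_deleteEdges_of_connectedComponentMk_eq hK hne) ?_ hreach rfl rfl)
  intro c d hcd
  rw [SimpleGraph.deleteEdges_adj] at hcd
  obtain ⟨⟨-, a', b', rfl, rfl, hab'⟩, hne'⟩ := hcd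
  refine ⟨a', b', rfl, rfl, SimpleGraph.Adj.reachable ?_⟩
  rw [SimpleGraph.deleteEdges_adj]
  refine ⟨hab', fun h => hne' ?_⟩
  exact congrArg (Sym2.map K.connectedComponentMk) (Set.mem_singleton_iff.1 h)

theorem collapse_fiber_connected (hK : K ≤ T.graph) (c : K.ConnectedComponent) :
    (T.graph.induce (K.connectedComponentMk ⁻¹' {c})).Connected :=
  c.connected_toSimpleGraph.of_surjective_of_adj_reachable id Function.surjective_id
    fun _ _ h => SimpleGraph.Adj.reachable (hK h)

/-- The tree obtained from `T` by collapsing an invariant set `K` of edges. -/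
def collapse (hK : K ≤ T.graph)
    (hKact : ∀ g a b, K.Adj a b → K.Adj (T.act g a) (T.act g b)) : GTree G where
  V := K.ConnectedComponent
  graph := T.collapseGraph K
  nonempty := T.nonempty.map K.connectedComponentMk
  connected := T.connected.of_surjective_of_adj_reachable K.connectedComponentMk
    Quot.mk_surjective fun a b h => by
      by_cases hab : K.connectedComponentMk a = K.connectedComponentMk b
      · rw [hab]
      · exact SimpleGraph.Adj.reachable ⟨hab, a, b, rfl, rfl, h⟩
  acyclic := collapseGraph_acyclic hK
  act g := SimpleGraph.ConnectedComponent.map ⟨T.act g, fun {a b} => hKact g a b⟩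
  act_one := by
    rintro ⟨a⟩
    exact congrArg K.connectedComponentMk (T.act_one a)
  act_mul := by
    rintro g h ⟨a⟩
    exact congrArg K.connectedComponentMk (T.act_mul g h a)
  act_adj := by
    rintro g _ _ ⟨hne, a, b, rfl, rfl, hab⟩
    refine ⟨fun h => hne ?_, T.act g a, T.act g b, rfl, rfl, T.act_adj g a b hab⟩
    have := congrArg (SimpleGraph.ConnectedComponent.map ⟨T.act g⁻¹, fun {a b} => hKact g⁻¹ a b⟩) h
    change K.connectedComponentMk (T.act g⁻¹ (T.act g a)) =
      K.connectedComponentMk (T.act g⁻¹ (T.act g b)) at this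
    simpa only [← T.act_mul, inv_mul_cancel, T.act_one] using this
  noInversion := by
    rintro g _ _ ⟨hne, a, b, rfl, rfl, hab⟩ ⟨h1, h2⟩
    obtain ⟨h3, h4⟩ := adj_unique_of_connectedComponentMk hK hne hab (T.act_adj g a b hab).symm h2 h1
    exact T.noInversion g a b hab ⟨h4, h3⟩
  minimal S hne hS hSc := by
    have huniv := T.minimal (K.connectedComponentMk ⁻¹' S) (hne.preimage Quot.mk_surjective)
      (fun g a ha => hS g _ ha) ?_
    · refine Set.eq_univ_of_forall ?_
      rintro ⟨a⟩
      exact Set.eq_univ_iff_forall.1 huniv a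
    have := (hne.preimage (f := K.connectedComponentMk) Quot.mk_surjective).to_subtype
    refine ⟨fun a b => SimpleGraph.Reachable.lift_of_fibers
      (fun x : K.connectedComponentMk ⁻¹' S => (⟨K.connectedComponentMk x.1, x.2⟩ : S))
      ?_ ?_ (hSc.preconnected ⟨_, a.2⟩ ⟨_, b.2⟩) rfl rfl⟩
    · rintro ⟨a, ha⟩ ⟨b, hb⟩ hab
      have hab' : K.connectedComponentMk a = K.connectedComponentMk b := congrArg Subtype.val hab
      exact ((collapse_fiber_connected hK (K.connectedComponentMk b)).preconnected
        ⟨a, hab'⟩ ⟨b, rfl⟩).map_of_adj_reachable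
        (H := T.graph.induce (K.connectedComponentMk ⁻¹' S))
        (fun x => ⟨x.1, by
          rw [Set.mem_preimage, show K.connectedComponentMk x.1 = _ from x.2]; exact hb⟩)
        fun _ _ h => SimpleGraph.Adj.reachable h
    · rintro ⟨_, hc⟩ ⟨_, hd⟩ ⟨-, a, b, rfl, rfl, hab⟩
      exact ⟨⟨a, hc⟩, ⟨b, hd⟩, rfl, rfl, SimpleGraph.Adj.reachable hab⟩

theorem isCollapseMap_collapse (hK : K ≤ T.graph)
    (hKact : ∀ g a b, K.Adj a b → K.Adj (T.act g a) (T.act g b)) :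
    IsCollapseMap T (collapse hK hKact) K.connectedComponentMk :=
  ⟨fun _ _ => rfl, Quot.mk_surjective,
    fun a b hab => or_iff_not_imp_left.2 fun hne => ⟨hne, a, b, rfl, rfl, hab⟩,
    collapse_fiber_connected hK⟩

theorem connectedComponentMk_eq_iff_adj (hK : K ≤ T.graph) {a b : T.V} (hab : T.graph.Adj a b) :
    K.connectedComponentMk a = K.connectedComponentMk b ↔ K.Adj a b := by
  refine ⟨fun h => ?_, SimpleGraph.ConnectedComponent.connectedComponentMk_eq_of_adj⟩
  by_contra hnot
  refine T.acyclic.not_reachable_deleteEdges hab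
    ((SimpleGraph.ConnectedComponent.exact h).mono fun c d hcd => ?_)
  rw [SimpleGraph.deleteEdges_adj]
  refine ⟨hK hcd, fun h => hnot ?_⟩
  have : s(c, d) ∈ K.edgeSet := hcd
  rwa [Set.mem_singleton_iff.1 h] at this

theorem exists_edgeStab_collapse_le (hK : K ≤ T.graph)
    (hKact : ∀ g a b, K.Adj a b → K.Adj (T.act g a) (T.act g b))
    {c d : (collapse hK hKact).V}
    (hcd : (collapse hK hKact).graph.Adj c d) :
    ∃ a b, T.graph.Adj a b ∧ ¬K.Adj a b ∧ (collapse hK hKact).edgeStab c d ≤ T.edgeStab a b := by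
  obtain ⟨hne, a, b, rfl, rfl, hab⟩ := hcd
  exact ⟨a, b, hab, fun h => hne ((connectedComponentMk_eq_iff_adj hK hab).2 h), fun g hg =>
    adj_unique_of_connectedComponentMk hK hne hab (T.act_adj g a b hab) hg.1 hg.2⟩

end Collapse

/-- Two trees `T₁`, `T₂` such that the edge stabilizers of `T₁` are elliptic in `T₂` admit a
refinement of `T₁` with an equivariant map to the vertices of `T₂`, such that every edge either
has stabilizer fixing an edge of `T₂`, or has stabilizer fixing an edge of `T₁` and maps to a
vertex of `T₂`. -/
theorem exists_refinement (hfg : Group.FG G) (T₁ T₂ : GTree G)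
    (hell : ∀ a b, T₁.graph.Adj a b → T₂.EllipticSubgroup (T₁.edgeStab a b)) :
    ∃ (S : GTree G) (f : S.V → T₁.V) (π : S.V → T₂.V), IsCollapseMap S T₁ f ∧
      (∀ g a, π (S.act g a) = T₂.act g (π a)) ∧
      ∀ a b, S.graph.Adj a b →
        (∃ x y, T₂.graph.Adj x y ∧ S.edgeStab a b ≤ T₂.edgeStab x y) ∨
        (π a = π b ∧ ∃ v w, T₁.graph.Adj v w ∧ S.edgeStab a b ≤ T₁.edgeStab v w) := by
  have := T₂.nonempty
  let _ : MulAction G (Sym2 T₁.V) :=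
    { smul := fun g => Sym2.map (T₁.act g)
      one_smul := by
        rintro ⟨a, b⟩
        change s(T₁.act 1 a, T₁.act 1 b) = s(a, b)
        rw [T₁.act_one, T₁.act_one]
      mul_smul := by
        rintro g h ⟨a, b⟩
        change s(T₁.act _ a, T₁.act _ b) = s(T₁.act g (T₁.act h a), T₁.act g (T₁.act h b))
        rw [T₁.act_mul, T₁.act_mul] }
  obtain ⟨p, hp⟩ := exists_equivariant_map (G := G) (X := Sym2 T₁.V) (Y := T₂.V)
    (fun e => e ∈ T₁.graph.edgeSet) (by rintro g ⟨a, b⟩ h; exact T₁.act_adj g a b h) (by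
      rintro ⟨a, b⟩ hab
      obtain ⟨y, hy⟩ := hell a b hab
      refine ⟨y, fun g hg => hy g ?_⟩
      have hg' : s(T₁.act g a, T₁.act g b) = s(a, b) := hg
      rcases Sym2.eq_iff.1 hg' with h | h
      · exact h
      · exact absurd h (T₁.noInversion g a b hab))
  have hp' : ∀ v w, T₁.graph.Adj v w → ∀ g : G,
      p s(T₁.act g v, T₁.act g w) = T₂.act g (p s(v, w)) := fun v w h g => hp s(v, w) h g
  let P := blowUp T₁.graph T₂.graph p
  have hPac : P.IsAcyclic := blowUp_acyclic T₁.acyclic T₂.acyclic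
  have hact : ∀ (g : G) a b, P.Adj a b → P.Adj (g • a) (g • b) := by
    rintro g ⟨v, x⟩ ⟨w, y⟩ (⟨h, hxy⟩ | ⟨hvw, h, hx⟩)
    · exact Or.inl ⟨congrArg (T₁.act g) h, T₂.act_adj g x y hxy⟩
    · refine Or.inr ⟨T₁.act_adj g v w hvw, congrArg (T₂.act g) h, ?_⟩
      exact (congrArg (T₂.act g) hx).trans (hp' v w hvw g).symm
  have hinv : ∀ (g : G) a b, P.Adj a b → ¬(g • a = b ∧ g • b = a) := by
    rintro g ⟨v, x⟩ ⟨w, y⟩ (⟨-, hxy⟩ | ⟨hvw, -⟩) ⟨h1, h2⟩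
    · exact T₂.noInversion g x y hxy ⟨congrArg Prod.snd h1, congrArg Prod.snd h2⟩
    · exact T₁.noInversion g v w hvw ⟨congrArg Prod.fst h1, congrArg Prod.fst h2⟩
  obtain ⟨M, hMne, hMinv, hMc, hMmin⟩ := exists_minimal_invariant_connected hfg P
    (blowUp_connected T₁.connected T₂.connected) hact
  have hadj : ∀ a b, P.Adj a b → a.1 = b.1 ∨ T₁.graph.Adj a.1 b.1 := fun a b h =>
    h.imp (fun h => h.1) fun h => h.1
  have hsurj : Prod.fst '' M = Set.univ := by
    refine T₁.minimal _ (hMne.image _) ?_ ?_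
    · rintro g _ ⟨a, ha, rfl⟩
      exact ⟨g • a, hMinv g a ha, rfl⟩
    · refine hMc.of_surjective_of_adj_reachable (fun a => ⟨a.1.1, a.1, a.2, rfl⟩) ?_ ?_
      · rintro ⟨_, a, ha, rfl⟩
        exact ⟨⟨a, ha⟩, rfl⟩
      · rintro ⟨a, ha⟩ ⟨b, hb⟩ hab
        rcases hadj a b hab with h | h
        · simp only [h]
          exact .rfl
        · exact SimpleGraph.Adj.reachable h
  refine ⟨ofMinimalSubset P hPac hact hinv M hMne hMinv hMc hMmin, fun a => a.1.1,
    fun a => a.1.2, ⟨fun _ _ => rfl, ?_, fun a b h => hadj a.1 b.1 h, ?_⟩, fun _ _ => rfl, ?_⟩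
  · intro v
    obtain ⟨a, ha, rfl⟩ := Set.eq_univ_iff_forall.1 hsurj v
    exact ⟨⟨a, ha⟩, rfl⟩
  · intro v
    obtain ⟨a, ha, rfl⟩ := Set.eq_univ_iff_forall.1 hsurj v
    refine (hPac.connected_induce_inter hMc (blowUp_fiber_connected T₂.connected a.1)
      ⟨a, ha, rfl⟩).of_surjective_of_adj_reachable (fun x => ⟨⟨x.1, x.2.1⟩, x.2.2⟩) ?_
      fun _ _ h => SimpleGraph.Adj.reachable h
    rintro ⟨⟨x, hx⟩, hxv⟩
    exact ⟨⟨x, hx, hxv⟩, rfl⟩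
  · rintro ⟨a, ha⟩ ⟨b, hb⟩ hab
    have hstab : ∀ g ∈ (ofMinimalSubset P hPac hact hinv M hMne hMinv hMc hMmin).edgeStab
        ⟨a, ha⟩ ⟨b, hb⟩, g • a = a ∧ g • b = b := fun g hg =>
      ⟨congrArg Subtype.val hg.1, congrArg Subtype.val hg.2⟩
    rcases hab with ⟨-, hxy⟩ | ⟨hvw, h, -⟩
    · exact Or.inl ⟨a.2, b.2, hxy, fun g hg =>
        ⟨congrArg Prod.snd (hstab g hg).1, congrArg Prod.snd (hstab g hg).2⟩⟩
    · exact Or.inr ⟨h, a.1, b.1, hvw, fun g hg =>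
        ⟨congrArg Prod.fst (hstab g hg).1, congrArg Prod.fst (hstab g hg).2⟩⟩

end GTree

/-- some JSJ tree over `𝒜` is compatible with a given JSJ tree over `ℬ`:
it is obtained from a common refinement by collapsing exactly the edges with stabilizer
not in `𝒜`. -/
theorem jsj_compatible {G : Type u} [Group G] (hfg : Group.FG G)
    (𝒜 ℬ : Set (Subgroup G)) (h𝒜 : ClosedFamily 𝒜) (hℬ : ClosedFamily ℬ)
    (hsub : 𝒜 ⊆ ℬ)
    (Tb : GTree G) (hTb : Tb.IsJSJ ℬ)
    (hex : ∃ Ta : GTree G, Ta.IsJSJ 𝒜) :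
    ∃ (S : GTree G) (f : S.V → Tb.V) (T' : GTree G) (q : S.V → T'.V),
      GTree.IsCollapseMap S Tb f ∧ GTree.IsCollapseMap S T' q ∧
      (∀ a b : S.V, S.graph.Adj a b → (q a = q b ↔ S.edgeStab a b ∉ 𝒜)) ∧
      T'.IsJSJ 𝒜 := by
  obtain ⟨Ta, hTa, hTaUE, hTaDom⟩ := hex
  have hTbUE : Tb.UnivEllipticTree 𝒜 := fun a b hab T hT =>
    hTb.2.1 a b hab T fun x y hxy => hsub (hT x y hxy)
  obtain ⟨S, f, π, hf, hπ, hedge⟩ := GTree.exists_refinement hfg Tb Ta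
    fun a b hab => hTbUE a b hab Ta hTa
  let K : SimpleGraph S.V :=
    { Adj := fun a b => S.graph.Adj a b ∧ S.edgeStab a b ∉ 𝒜
      symm := ⟨fun a b h => ⟨h.1.symm, by rw [GTree.edgeStab, inf_comm]; exact h.2⟩⟩
      loopless := ⟨fun _ h => h.1.ne rfl⟩ }
  have hK : K ≤ S.graph := fun _ _ h => h.1
  have hKact : ∀ g a b, K.Adj a b → K.Adj (S.act g a) (S.act g b) := fun g a b h =>
    ⟨S.act_adj g a b h.1, (GTree.edgeStab_act_mem_iff h𝒜 S g a b).not.2 h.2⟩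
  refine ⟨S, f, GTree.collapse hK hKact, K.connectedComponentMk, hf,
    GTree.isCollapseMap_collapse hK hKact, fun a b hab => ?_, ?_, ?_, ?_⟩
  · exact (GTree.connectedComponentMk_eq_iff_adj hK hab).trans (and_iff_right hab)
  · intro c d hcd
    obtain ⟨a, b, hab, hnot, hle⟩ := GTree.exists_edgeStab_collapse_le hK hKact hcd
    exact h𝒜.2 _ (not_not.1 fun h => hnot ⟨hab, h⟩) _ hle
  · intro c d hcd
    obtain ⟨a, b, hab, -, hle⟩ := GTree.exists_edgeStab_collapse_le hK hKact hcd
    rcases hedge a b hab with ⟨x, y, hxy, hle'⟩ | ⟨-, v, w, hvw, hle'⟩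
    · exact (hTaUE x y hxy).mono (hle.trans hle')
    · exact (hTbUE v w hvw).mono (hle.trans hle')
  · intro T hT hTUE H ⟨c, hc⟩
    refine hTaDom T hT hTUE H ?_
    obtain ⟨a, rfl⟩ := Quot.mk_surjective c
    refine ⟨π a, fun h hh => ?_⟩
    have hconst : ∀ x y, K.Adj x y → π x = π y := by
      rintro x y ⟨hxy, hnot⟩
      rcases hedge x y hxy with ⟨v, w, hvw, hle⟩ | ⟨h, -⟩
      · exact absurd (h𝒜.2 _ (hTa v w hvw) _ hle) hnot
      · exact h
    have hreach : K.Reachable (S.act h a) a := SimpleGraph.ConnectedComponent.exact (hc h hh)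
    rw [← hπ]
    obtain ⟨w⟩ := hreach
    generalize S.act h a = b at w
    induction w with
    | nil => rfl
    | cons hadj _ ih => exact (hconst _ _ hadj).trans (ih hc)
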